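/- arXiv:2605.29843 — 2 statements merged into one kernel-verified Lean document; each statement's English description precedes it below -/
import Mathlib

section
/- Let b = 2^k for some k ≥ 1, let m ≥ 1, and let d = b^m. Let H_b = (2^k)^{-1/2} · H̃_k be the normalized Sylvester Hadamard matrix of size b, and for each stage t ∈ {0, …, m−1} define the stride-stage matrix S_t = I_{b^{m−t−1}} ⊗ H_b ⊗ I_{b^t}, viewed as a d×d real matrix under the lexicographic identification of Fin b^{m−t−1} × Fin b × Fin b^t with Fin d. Then there exists a d×d permutation matrix P such that S_{m−1} · S_{m−2} ⋯ S_0 = Pᵀ · H_d · P, where H_d = (2^{km})^{-1/2} · H̃_{km} is the normalized Sylvester Hadamard matrix of size d. -/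
open Matrix Kronecker

/-- The unnormalized Sylvester Hadamard matrices: `H̃_0 = (1)` and
`H̃_{k+1} = fromBlocks H̃_k H̃_k H̃_k (−H̃_k)`, reindexed to `Fin (2^(k+1))`. -/
def sylvester : (k : ℕ) → Matrix (Fin (2 ^ k)) (Fin (2 ^ k)) ℝ
  | 0 => 1
  | k + 1 =>
    Matrix.reindex (finSumFinEquiv.trans (finCongr (by rw [pow_succ, mul_two])))
      (finSumFinEquiv.trans (finCongr (by rw [pow_succ, mul_two])))
      (Matrix.fromBlocks (sylvester k) (sylvester k) (sylvester k) (-sylvester k))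

/-- The normalized Sylvester Hadamard matrix `H_{2^k} = (2^k)^{-1/2} · H̃_k`. -/
noncomputable def hadamardNorm (k : ℕ) : Matrix (Fin (2 ^ k)) (Fin (2 ^ k)) ℝ :=
  (((2 : ℝ) ^ k) ^ (-(1 / 2) : ℝ)) • sylvester k

/-- Lexicographic identification of `Fin g × Fin b × Fin s` with `Fin (g·(b·s))`,
`(α, r, β) ↦ α·(b·s) + r·s + β`. -/
def lex3 (g b s : ℕ) : Fin g × Fin b × Fin s ≃ Fin (g * (b * s)) :=
  ((Equiv.refl (Fin g)).prodCongr finProdFinEquiv).trans finProdFinEquiv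

theorem pow_stage_arith (b m t : ℕ) (ht : t < m) : b ^ (m - t - 1) * (b * b ^ t) = b ^ m := by
  rw [← pow_succ', ← pow_add]; congr 1; omega

/-- The stride-stage matrix `S_t = I_{b^(m−t−1)} ⊗ H_b ⊗ I_{b^t}` (with `b = 2^k`),
viewed as a `d × d` matrix (`d = b^m`) under the lexicographic identification of
`Fin b^(m−t−1) × Fin b × Fin b^t` with `Fin d`. -/
noncomputable def strideStage (k m : ℕ) (t : Fin m) :
    Matrix (Fin ((2 ^ k) ^ m)) (Fin ((2 ^ k) ^ m)) ℝ :=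
  Matrix.reindex
    ((lex3 ((2 ^ k) ^ (m - t - 1)) (2 ^ k) ((2 ^ k) ^ (t : ℕ))).trans
      (finCongr (pow_stage_arith (2 ^ k) m t t.isLt)))
    ((lex3 ((2 ^ k) ^ (m - t - 1)) (2 ^ k) ((2 ^ k) ^ (t : ℕ))).trans
      (finCongr (pow_stage_arith (2 ^ k) m t t.isLt)))
    ((1 : Matrix (Fin ((2 ^ k) ^ (m - t - 1))) (Fin ((2 ^ k) ^ (m - t - 1))) ℝ) ⊗ₖ
      (hadamardNorm k ⊗ₖ
        (1 : Matrix (Fin ((2 ^ k) ^ (t : ℕ))) (Fin ((2 ^ k) ^ (t : ℕ))) ℝ)))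

/-- The Kronecker product of two matrices indexed by `Fin p` and `Fin q`, reindexed
lexicographically to `Fin n`, where `n = p * q`. -/
def kronFin {p q n : ℕ} (h : p * q = n) (A : Matrix (Fin p) (Fin p) ℝ)
    (B : Matrix (Fin q) (Fin q) ℝ) : Matrix (Fin n) (Fin n) ℝ :=
  Matrix.reindex (finProdFinEquiv.trans (finCongr h)) (finProdFinEquiv.trans (finCongr h))
    (A ⊗ₖ B)

section kronFin

variable {p q r n : ℕ}

theorem kronFin_apply (h : p * q = n) (A : Matrix (Fin p) (Fin p) ℝ)
    (B : Matrix (Fin q) (Fin q) ℝ) (i j : Fin n) :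
    kronFin h A B i j =
      A (Fin.cast h.symm i).divNat (Fin.cast h.symm j).divNat *
        B (Fin.cast h.symm i).modNat (Fin.cast h.symm j).modNat :=
  rfl

theorem kronFin_mul (h : p * q = n) (A A' : Matrix (Fin p) (Fin p) ℝ)
    (B B' : Matrix (Fin q) (Fin q) ℝ) :
    kronFin h A B * kronFin h A' B' = kronFin h (A * A') (B * B') := by
  simp only [kronFin, Matrix.reindex_apply, Matrix.mul_kronecker_mul,
    Matrix.submatrix_mul_equiv]

theorem kronFin_one_one (h : p * q = n) : kronFin h 1 1 = 1 := by
  rw [kronFin, Matrix.one_kronecker_one, Matrix.reindex_apply, Matrix.submatrix_one_equiv]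

theorem kronFin_smul_smul (h : p * q = n) (x y : ℝ) (A : Matrix (Fin p) (Fin p) ℝ)
    (B : Matrix (Fin q) (Fin q) ℝ) :
    kronFin h (x • A) (y • B) = (x * y) • kronFin h A B := by
  ext i j
  simp only [kronFin_apply, Matrix.smul_apply, smul_eq_mul]
  ring

theorem kronFin_assoc {pq qr : ℕ} (hqr : q * r = qr) (hpq : p * q = pq) (h : p * qr = n)
    (h' : pq * r = n) (A : Matrix (Fin p) (Fin p) ℝ) (B : Matrix (Fin q) (Fin q) ℝ)
    (C : Matrix (Fin r) (Fin r) ℝ) :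
    kronFin h A (kronFin hqr B C) = kronFin h' (kronFin hpq A B) C := by
  subst hqr hpq h'
  have hdiv (i : Fin (p * q * r)) :
      (Fin.cast h.symm i).divNat = (i.divNat : Fin (p * q)).divNat := by
    ext; simp [Nat.div_div_eq_div_mul, mul_comm]
  have hmid (i : Fin (p * q * r)) :
      (Fin.cast h.symm i).modNat.divNat = (i.divNat : Fin (p * q)).modNat := by
    ext; simp [mul_comm q r, Nat.mod_mul_right_div_self]
  have hmod (i : Fin (p * q * r)) :
      (Fin.cast h.symm i).modNat.modNat = i.modNat := by
    ext; simp
  ext i j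
  simp only [kronFin_apply, Fin.cast_eq_self, hdiv, hmid, hmod, mul_assoc]

theorem kronFin_one_left (hp : p = 1) (h : p * n = n) (A : Matrix (Fin n) (Fin n) ℝ) :
    kronFin h 1 A = A := by
  subst hp
  ext i j
  have hmod (i : Fin n) : (Fin.cast h.symm i).modNat = i := by
    ext; simp [Nat.mod_eq_of_lt i.isLt]
  rw [kronFin_apply, hmod, hmod, Subsingleton.elim (Fin.divNat _) (Fin.cast h.symm j).divNat,
    Matrix.one_apply_eq, one_mul]

theorem kronFin_reindex_right {q' : ℕ} (hq : q' = q) (h : p * q = n) (h' : p * q' = n)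
    (A : Matrix (Fin p) (Fin p) ℝ) (B : Matrix (Fin q') (Fin q') ℝ) :
    kronFin h A (Matrix.reindex (finCongr hq) (finCongr hq) B) = kronFin h' A B := by
  subst hq
  rfl

theorem reindex_kronFin {n' : ℕ} (hn : n = n') (h : p * q = n) (h' : p * q = n')
    (A : Matrix (Fin p) (Fin p) ℝ) (B : Matrix (Fin q) (Fin q) ℝ) :
    Matrix.reindex (finCongr hn) (finCongr hn) (kronFin h A B) = kronFin h' A B := by
  subst hn
  rfl

theorem prod_map_kronFin_one (h : p * q = n) (l : List (Matrix (Fin q) (Fin q) ℝ)) :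
    (l.map (kronFin h 1)).prod = kronFin h 1 l.prod := by
  induction l with
  | nil => simp [kronFin_one_one]
  | cons A l ih => simp [ih, kronFin_mul]

end kronFin

theorem sylvester_succ (k : ℕ) :
    sylvester (k + 1) = kronFin (pow_succ' 2 k).symm !![1, 1; 1, -1] (sylvester k) := by
  have hn : 2 ^ k + 2 ^ k = 2 ^ (k + 1) := by rw [pow_succ, mul_two]
  have hinl (i : Fin (2 ^ k)) : finSumFinEquiv.trans (finCongr hn) (Sum.inl i) =
      finProdFinEquiv.trans (finCongr (pow_succ' 2 k).symm) ((0 : Fin 2), i) := by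
    ext; simp
  have hinr (i : Fin (2 ^ k)) : finSumFinEquiv.trans (finCongr hn) (Sum.inr i) =
      finProdFinEquiv.trans (finCongr (pow_succ' 2 k).symm) ((1 : Fin 2), i) := by
    ext; simp
  rw [sylvester, kronFin, ← Equiv.eq_symm_apply]
  ext (i | i) (j | j) <;>
    simp only [Matrix.reindex_symm, Matrix.reindex_apply, Matrix.submatrix_apply,
      Equiv.symm_symm, hinl, hinr, Equiv.symm_apply_apply] <;>
    simp

theorem sylvester_add (a b : ℕ) :
    sylvester (a + b) = kronFin (pow_add 2 a b).symm (sylvester a) (sylvester b) := by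
  suffices H : ∀ n (hn : n = a + b), sylvester n =
      kronFin (by rw [hn, pow_add]) (sylvester a) (sylvester b) from H _ rfl
  induction a with
  | zero =>
    rintro n hn
    obtain rfl : n = b := by simpa using hn
    exact (kronFin_one_left (pow_zero 2) _ _).symm
  | succ a ih =>
    rintro n hn
    obtain rfl : n = a + b + 1 := by omega
    rw [sylvester_succ, ih _ rfl, sylvester_succ]
    exact kronFin_assoc _ _ _ _ _ _ _

theorem hadamardNorm_add {n a b : ℕ} (hn : n = a + b) :
    hadamardNorm n =
      kronFin (by rw [hn, pow_add]) (hadamardNorm a) (hadamardNorm b) := by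
  subst hn
  rw [hadamardNorm, sylvester_add, hadamardNorm, hadamardNorm, kronFin_smul_smul,
    ← Real.mul_rpow (by positivity) (by positivity), ← pow_add (2 : ℝ)]

theorem strideStage_eq_kronFin (k m : ℕ) (t : Fin m) :
    strideStage k m t =
      kronFin (pow_stage_arith (2 ^ k) m t t.isLt) 1 (kronFin rfl (hadamardNorm k) 1) :=
  rfl

theorem strideStage_castSucc (k m : ℕ) (t : Fin m) :
    strideStage k (m + 1) t.castSucc =
      kronFin (pow_succ' (2 ^ k) m).symm 1 (strideStage k m t) := by
  have hexp : 2 ^ k * (2 ^ k) ^ (m - t - 1) = (2 ^ k) ^ (m + 1 - t.castSucc - 1) := by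
    rw [← pow_succ', Fin.val_castSucc]; congr 1; omega
  rw [strideStage_eq_kronFin, strideStage_eq_kronFin,
    kronFin_assoc _ hexp _ (pow_stage_arith (2 ^ k) (m + 1) t.castSucc t.castSucc.isLt),
    kronFin_one_one]

theorem strideStage_last (k m : ℕ) :
    strideStage k (m + 1) (Fin.last m) =
      kronFin (pow_succ' (2 ^ k) m).symm (hadamardNorm k) 1 := by
  have hg : (2 ^ k) ^ (m + 1 - (Fin.last m : ℕ) - 1) = 1 := by simp
  rw [strideStage_eq_kronFin, kronFin_assoc _ (by rw [hg, one_mul]) _ (pow_succ' (2 ^ k) m).symm,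
    kronFin_one_left hg]

/-- The stages compose to the Hadamard matrix itself: with lexicographic digits, no
permutation is needed. -/
theorem prod_strideStage (k m : ℕ) :
    (List.ofFn fun t : Fin m => strideStage k m t).reverse.prod =
      Matrix.reindex (finCongr (pow_mul 2 k m)) (finCongr (pow_mul 2 k m))
        (hadamardNorm (k * m)) := by
  induction m with
  | zero =>
    ext i j
    have hij : i = j := Fin.ext (by have := i.isLt; have := j.isLt; simp_all)
    subst hij
    rw [List.ofFn_zero, List.reverse_nil, List.prod_nil, Matrix.one_apply_eq,
      Matrix.reindex_apply, Matrix.submatrix_apply]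
    simp [hadamardNorm, sylvester]
  | succ m ih =>
    have hmap : (List.ofFn fun t : Fin m => strideStage k (m + 1) t.castSucc) =
        (List.ofFn fun t : Fin m => strideStage k m t).map
          (kronFin (pow_succ' (2 ^ k) m).symm 1) := by
      simp only [strideStage_castSucc, List.map_ofFn, Function.comp_def]
    rw [List.ofFn_succ', List.concat_eq_append, List.reverse_append, List.reverse_singleton,
      List.singleton_append, List.prod_cons, hmap, ← List.map_reverse, prod_map_kronFin_one,
      ih, strideStage_last, kronFin_mul, mul_one, one_mul,
      hadamardNorm_add (show k * (m + 1) = k + k * m by ring)]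
    have h : 2 ^ k * 2 ^ (k * m) = (2 ^ k) ^ (m + 1) := by rw [pow_succ', pow_mul]
    rw [kronFin_reindex_right _ _ h, reindex_kronFin _ _ h]

/-- with `b = 2^k` (`k ≥ 1`), `m ≥ 1`, `d = b^m`, there is a `d × d`
permutation matrix `P` such that `S_{m−1} · S_{m−2} ⋯ S_0 = Pᵀ · H_d · P`, where
`H_d = (2^{km})^{-1/2} · H̃_{km}` is the normalized Sylvester Hadamard matrix of size `d`. -/
theorem strideStage_prod_eq_hadamard (k m : ℕ) (hk : 1 ≤ k) (hm : 1 ≤ m) :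
    ∃ σ : Equiv.Perm (Fin ((2 ^ k) ^ m)),
      ((List.ofFn fun t : Fin m => strideStage k m t).reverse.prod) =
        (σ.toPEquiv.toMatrix : Matrix (Fin ((2 ^ k) ^ m)) (Fin ((2 ^ k) ^ m)) ℝ)ᵀ *
          Matrix.reindex (finCongr (pow_mul 2 k m)) (finCongr (pow_mul 2 k m))
            (hadamardNorm (k * m)) *
          (σ.toPEquiv.toMatrix : Matrix (Fin ((2 ^ k) ^ m)) (Fin ((2 ^ k) ^ m)) ℝ) := by
  refine ⟨1, ?_⟩
  rw [prod_strideStage, Equiv.Perm.one_def, Equiv.toPEquiv_refl, PEquiv.toMatrix_refl,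
    Matrix.transpose_one, one_mul, mul_one]
end

section
/- Let b = 2^k for some k ≥ 1, let m ≥ 1, and let d = b^m. For each stage t ∈ {0, …, m−1}, let the HARP stage at initialization be S_t = Q_tᵀ · blockDiagonal(B_{t,1}, …, B_{t,D_t}) · Q_t, where D_t = d/b, every block B_{t,c} equals the normalized Sylvester Hadamard matrix H_b = (2^k)^{-1/2} · H̃_k, and Q_t is the perfect-shuffle permutation matrix that groups the stride-b^t coordinate groups of stage t into contiguous blocks. Then the initialized transform T(0) = S_{m−1} ⋯ S_0 satisfies T(0) = Pᵀ · H_d · P for some fixed d×d permutation matrix P, where H_d = (2^{km})^{-1/2} · H̃_{km} is the normalized Sylvester Hadamard matrix of size d. -/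
open Matrix Kronecker

theorem pow_stage_arith' (b m t : ℕ) (ht : t < m) : b ^ (m - t - 1) * b ^ t * b = b ^ m := by
  rw [← pow_add, ← pow_succ]; congr 1; omega

/-- The HARP stage at initialization: `S_t = Q_tᵀ · blockDiagonal(H_b, …, H_b) · Q_t`, where
every block equals the normalized Sylvester Hadamard `H_b` (`b = 2^k`, `d/b` blocks) and
`Q_t` is the perfect-shuffle permutation matrix grouping the stride-`b^t` coordinate groups
of stage `t` (lexicographic index `α·(b·b^t) + r·b^t + β ↦ ((α, β), r)`) into contiguous
blocks. -/
noncomputable def harpStageInit (k m : ℕ) (t : Fin m) :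
    Matrix (Fin ((2 ^ k) ^ m)) (Fin ((2 ^ k) ^ m)) ℝ :=
  let b := 2 ^ k
  let g := b ^ (m - t - 1)
  let s := b ^ (t : ℕ)
  -- lexicographic identification of the stage-t triple index with `Fin d`
  let lexE : Fin g × Fin b × Fin s ≃ Fin (b ^ m) :=
    (lex3 g b s).trans (finCongr (pow_stage_arith b m t t.isLt))
  -- contiguous flattening of the grouped layout `(Fin g × Fin s) × Fin b` into `Fin d`
  let groupE : (Fin g × Fin s) × Fin b ≃ Fin (b ^ m) :=
    ((finProdFinEquiv.prodCongr (Equiv.refl (Fin b))).trans finProdFinEquiv).trans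
      (finCongr (pow_stage_arith' b m t t.isLt))
  -- the perfect shuffle `(α, r, β) ↦ ((α, β), r)`
  let shuf : Fin g × Fin b × Fin s ≃ (Fin g × Fin s) × Fin b :=
    { toFun := fun x => ((x.1, x.2.2), x.2.1)
      invFun := fun x => (x.1.1, x.2, x.1.2)
      left_inv := fun _ => rfl
      right_inv := fun _ => rfl }
  -- the perfect-shuffle permutation of `Fin d` for stage `t`
  let π : Equiv.Perm (Fin (b ^ m)) := lexE.symm.trans (shuf.trans groupE)
  -- its permutation matrix (grouping the strided coordinates into contiguous blocks)
  let Q : Matrix (Fin (b ^ m)) (Fin (b ^ m)) ℝ := (π⁻¹).toPEquiv.toMatrix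
  -- block diagonal matrix with `d/b` contiguous diagonal copies of `H_b`
  let M : Matrix (Fin (b ^ m)) (Fin (b ^ m)) ℝ :=
    Matrix.reindex ((Equiv.prodComm (Fin b) (Fin g × Fin s)).trans groupE)
      ((Equiv.prodComm (Fin b) (Fin g × Fin s)).trans groupE)
      (Matrix.blockDiagonal fun _ : Fin g × Fin s => hadamardNorm k)
  Qᵀ * M * Q

/-- The sign `(-1)^{|i ∧ j|}`, where `i ∧ j` is the bitwise conjunction of the lowest `k` bits. -/
noncomputable def walshSign (k i j : ℕ) : ℝ :=
  ∏ l ∈ Finset.range k, if i.testBit l && j.testBit l then -1 else 1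

theorem walshSign_congr {k i j i' j' : ℕ} (hi : i % 2 ^ k = i' % 2 ^ k)
    (hj : j % 2 ^ k = j' % 2 ^ k) : walshSign k i j = walshSign k i' j' := by
  refine Finset.prod_congr rfl fun l hl => ?_
  have hl : l < k := Finset.mem_range.mp hl
  have h₁ := congrArg (Nat.testBit · l) hi
  have h₂ := congrArg (Nat.testBit · l) hj
  simp only [Nat.testBit_mod_two_pow, hl, decide_true, Bool.true_and] at h₁ h₂
  rw [h₁, h₂]

theorem walshSign_add (a c i j : ℕ) :
    walshSign (a + c) i j = walshSign a i j * walshSign c (i / 2 ^ a) (j / 2 ^ a) := by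
  simp only [walshSign, Finset.prod_range_add, Nat.testBit_div_two_pow, Nat.add_comm]

theorem walshSign_succ (k i j : ℕ) :
    walshSign (k + 1) i j =
      walshSign k i j * if i.testBit k && j.testBit k then -1 else 1 :=
  Finset.prod_range_succ _ _

theorem sylvester_apply (k : ℕ) (i j : Fin (2 ^ k)) : sylvester k i j = walshSign k i j := by
  induction k with
  | zero =>
    have : i = j := Subsingleton.elim (α := Fin 1) i j
    subst this
    simp [sylvester, walshSign]
  | succ k ih =>
    obtain ⟨x, rfl⟩ := (finSumFinEquiv.trans
      (finCongr (show 2 ^ k + 2 ^ k = 2 ^ (k + 1) by rw [pow_succ, mul_two]))).surjective i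
    obtain ⟨y, rfl⟩ := (finSumFinEquiv.trans
      (finCongr (show 2 ^ k + 2 ^ k = 2 ^ (k + 1) by rw [pow_succ, mul_two]))).surjective j
    rw [sylvester, Matrix.reindex_apply, Matrix.submatrix_apply, Equiv.symm_apply_apply,
      Equiv.symm_apply_apply, walshSign_succ]
    have low (a : Fin (2 ^ k)) : (a : ℕ).testBit k = false := Nat.testBit_lt_two_pow a.isLt
    have high (a : Fin (2 ^ k)) : (2 ^ k + (a : ℕ)).testBit k = true := by
      rw [Nat.testBit_two_pow_add_eq, low]; rfl
    have shift (a c : ℕ) : walshSign k (2 ^ k + a) c = walshSign k a c :=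
      walshSign_congr (by simp) rfl
    have shift' (a c : ℕ) : walshSign k a (2 ^ k + c) = walshSign k a c :=
      walshSign_congr rfl (by simp)
    rcases x with x | x <;> rcases y with y | y <;>
      simp [low, high, shift, shift', ih, Nat.add_comm _ (2 ^ k)]

theorem transpose_toMatrix_mul_mul_apply {ι : Type*} [Fintype ι] [DecidableEq ι]
    (σ : Equiv.Perm ι) (M : Matrix ι ι ℝ) (i j : ι) :
    ((σ.toPEquiv.toMatrix : Matrix ι ι ℝ)ᵀ * M * (σ.toPEquiv.toMatrix : Matrix ι ι ℝ)) i j =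
      M (σ.symm i) (σ.symm j) := by
  rw [← PEquiv.toMatrix_symm, ← Equiv.toPEquiv_symm, PEquiv.toMatrix_toPEquiv_mul,
    PEquiv.mul_toMatrix_toPEquiv]
  rfl

theorem harpStageInit_apply (k m : ℕ) (t : Fin m) (i j : Fin ((2 ^ k) ^ m)) :
    harpStageInit k m t i j =
      if (i : ℕ) / (2 ^ k) ^ ((t : ℕ) + 1) = j / (2 ^ k) ^ ((t : ℕ) + 1) ∧
          (i : ℕ) % (2 ^ k) ^ (t : ℕ) = j % (2 ^ k) ^ (t : ℕ) then
        ((2 : ℝ) ^ k) ^ (-(1 / 2) : ℝ) *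
          walshSign k (i / (2 ^ k) ^ (t : ℕ)) (j / (2 ^ k) ^ (t : ℕ))
      else 0 := by
  set e := (lex3 ((2 ^ k) ^ (m - t - 1)) (2 ^ k) ((2 ^ k) ^ (t : ℕ))).trans
    (finCongr (pow_stage_arith (2 ^ k) m t t.isLt)) with he
  obtain ⟨⟨α, r, β⟩, rfl⟩ := e.surjective i
  obtain ⟨⟨α', r', β'⟩, rfl⟩ := e.surjective j
  have val (a : Fin ((2 ^ k) ^ (m - t - 1))) (c : Fin (2 ^ k)) (d : Fin ((2 ^ k) ^ (t : ℕ))) :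
      (e (a, c, d) : ℕ) = d + (2 ^ k) ^ (t : ℕ) * (c + 2 ^ k * a) := by
    simp [he, lex3, finProdFinEquiv]; ring
  have hs : 0 < (2 ^ k) ^ (t : ℕ) := by positivity
  have hdiv (a c d) : (e (a, c, d) : ℕ) / (2 ^ k) ^ (t : ℕ) = c + 2 ^ k * a := by
    rw [val, Nat.add_mul_div_left _ _ hs, Nat.div_eq_of_lt d.isLt, zero_add]
  have hmod (a c d) : (e (a, c, d) : ℕ) % (2 ^ k) ^ (t : ℕ) = d := by
    rw [val, Nat.add_mul_mod_self_left, Nat.mod_eq_of_lt d.isLt]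
  have hdiv' (a c d) : (e (a, c, d) : ℕ) / (2 ^ k) ^ ((t : ℕ) + 1) = a := by
    rw [pow_succ, ← Nat.div_div_eq_div_mul, hdiv, Nat.add_mul_div_left _ _ (by positivity),
      Nat.div_eq_of_lt c.isLt, zero_add]
  rw [hdiv', hdiv', hmod, hmod, hdiv, hdiv,
    walshSign_congr (i' := r) (j' := r') (by simp) (by simp)]
  simp only [harpStageInit, ← he, transpose_toMatrix_mul_mul_apply]
  simp [Matrix.blockDiagonal_apply, hadamardNorm, sylvester_apply, Fin.ext_iff, Equiv.Perm.inv_def]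

theorem prod_harpStageInit_apply (k m n : ℕ) (hn : n ≤ m) (i j : Fin ((2 ^ k) ^ m)) :
    (List.ofFn fun t : Fin n => harpStageInit k m (t.castLE hn)).reverse.prod i j =
      if (i : ℕ) / (2 ^ k) ^ n = j / (2 ^ k) ^ n then
        (((2 : ℝ) ^ k) ^ (-(1 / 2) : ℝ)) ^ n * walshSign (k * n) i j
      else 0 := by
  induction n generalizing i j with
  | zero => simp [walshSign, Matrix.one_apply, Fin.ext_iff]
  | succ n ih =>
    rw [List.ofFn_succ', List.concat_eq_append, List.reverse_append, List.reverse_singleton,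
      List.singleton_append, List.prod_cons, Matrix.mul_apply]
    have ih' := ih (by omega)
    simp only [Fin.castLE_castSucc] at ih' ⊢
    simp only [ih', harpStageInit_apply, Fin.val_castLE, Fin.val_last]
    set s := (2 ^ k) ^ n with hs
    have hs0 : 0 < s := by positivity
    have hdd (x : ℕ) : x / (2 ^ k) ^ (n + 1) = x / s / 2 ^ k := by
      rw [pow_succ, Nat.div_div_eq_div_mul]
    have hsk : 2 ^ (k * n) = s := pow_mul 2 k n
    simp only [hdd]
    split_ifs with h
    · have hlt : (j : ℕ) / s * s + i % s < (2 ^ k) ^ m := by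
        have hdvd : s ∣ (2 ^ k) ^ m := pow_dvd_pow _ (by omega)
        obtain ⟨q, hq⟩ := hdvd
        have hj : (j : ℕ) / s < q := Nat.div_lt_of_lt_mul (hq ▸ j.isLt)
        have hi := Nat.mod_lt (i : ℕ) hs0
        refine lt_of_lt_of_eq ?_ hq.symm
        nlinarith
      have hld : ((j : ℕ) / s * s + i % s) / s = j / s := by
        rw [mul_comm, Nat.mul_add_div hs0, Nat.div_eq_of_lt (Nat.mod_lt _ hs0), add_zero]
      have hlm : ((j : ℕ) / s * s + i % s) % s = i % s := by
        rw [mul_comm, Nat.mul_add_mod, Nat.mod_mod]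
      rw [Finset.sum_eq_single ⟨_, hlt⟩]
      · simp only [hld, hlm, h, and_self, if_true]
        rw [mul_add_one, walshSign_add, hsk, walshSign_congr (k := k * n) (i' := i) (j' := j)
          (by rw [hsk, hlm]) rfl]
        ring
      · intro l _ hl
        rw [ite_zero_mul_ite_zero, if_neg]
        rintro ⟨⟨-, h₁⟩, h₂⟩
        apply hl
        ext
        change (l : ℕ) = (j : ℕ) / s * s + i % s
        rw [← h₂, h₁, Nat.div_add_mod']
      · simp
    · refine Finset.sum_eq_zero fun l _ => ?_
      rw [ite_zero_mul_ite_zero, if_neg]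
      rintro ⟨⟨h₁, -⟩, h₂⟩
      exact h (by rw [h₁, h₂])

/-- the initialized HARP transform `T(0) = S_{m−1} ⋯ S_0` (each stage being a
perfect-shuffle conjugated block diagonal of normalized Sylvester Hadamard blocks `H_b`)
satisfies `T(0) = Pᵀ · H_d · P` for some fixed `d × d` permutation matrix `P`, where
`H_d = (2^{km})^{-1/2} · H̃_{km}` is the normalized Sylvester Hadamard matrix of size
`d = (2^k)^m`. -/
theorem harpInit_eq_hadamard (k m : ℕ) (hk : 1 ≤ k) (hm : 1 ≤ m) :
    ∃ σ : Equiv.Perm (Fin ((2 ^ k) ^ m)),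
      ((List.ofFn fun t : Fin m => harpStageInit k m t).reverse.prod) =
        (σ.toPEquiv.toMatrix : Matrix (Fin ((2 ^ k) ^ m)) (Fin ((2 ^ k) ^ m)) ℝ)ᵀ *
          Matrix.reindex (finCongr (pow_mul 2 k m)) (finCongr (pow_mul 2 k m))
            (hadamardNorm (k * m)) *
          (σ.toPEquiv.toMatrix : Matrix (Fin ((2 ^ k) ^ m)) (Fin ((2 ^ k) ^ m)) ℝ) := by
  refine ⟨Equiv.refl _, ?_⟩
  ext i j
  have h := prod_harpStageInit_apply k m m le_rfl i j
  rw [Nat.div_eq_of_lt i.isLt, Nat.div_eq_of_lt j.isLt, if_pos rfl] at h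
  refine h.trans ?_
  have hc : (((2 : ℝ) ^ k) ^ (-(1 / 2) : ℝ)) ^ m = ((2 : ℝ) ^ (k * m)) ^ (-(1 / 2) : ℝ) := by
    rw [pow_mul, Real.rpow_pow_comm (by positivity)]
  rw [transpose_toMatrix_mul_mul_apply, hc]
  simp [hadamardNorm, sylvester_apply]
end
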